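/- arXiv:gr-qc/0702059 — 3 statements merged into one kernel-verified Lean document; each statement's English description precedes it below -/
import Mathlib

section
/- Let L be a second-order Lagrangian and let Φ : ℝ⁴ → ℝᵏ be a smooth field satisfying the Euler–Lagrange equations E_a(x) = 0 for all a and all x ∈ ℝ⁴. Suppose X : ℝ⁴ → ℝ⁴ and Ψ : ℝ⁴ → ℝᵏ are smooth maps (an infinitesimal coordinate transformation δx = X and field transformation δΦ = Ψ) such that the infinitesimal invariance identity holds pointwise on ℝ⁴: ∑_a [ L_a Ψ_a + ∑_μ L_a^μ (∂_μ Ψ_a − ∑_σ ∂_σ Φ_a ∂_μ X^σ) + ∑_{μ,ν} L_a^{μν} (∂_μ ∂_ν Ψ_a − ∑_σ (∂_σ ∂_ν Φ_a ∂_μ X^σ + ∂_σ ∂_μ Φ_a ∂_ν X^σ + ∂_σ Φ_a ∂_μ ∂_ν X^σ)) ] + Λ ∑_σ ∂_σ X^σ = 0. Define W_a(x) := Ψ_a(x) − ∑_σ ∂_σ Φ_a(x) X^σ(x) and the Noether current j^μ(x) := Λ(x) X^μ(x) + ∑_a (L_a^μ − ∑_ν ∂_ν L_a^{μν}) W_a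 + ∑_{a,ν} L_a^{μν} ∂_ν W_a. Then ∑_μ ∂_μ j^μ(x) = 0 for all x ∈ ℝ⁴. -/
noncomputable section

/-- Partial derivative `∂_μ` of a real-valued function on `ℝ⁴ = Fin 4 → ℝ`. -/
def pd (μ : Fin 4) (f : (Fin 4 → ℝ) → ℝ) (x : Fin 4 → ℝ) : ℝ :=
  fderiv ℝ f x (Pi.single μ 1)

/-- A second-order Lagrangian: a function of `(u, p, q)` where `u ∈ ℝᵏ`,
`p ∈ (Fin 4 → ℝᵏ)` (first derivatives) and `q ∈ (Fin 4 → Fin 4 → ℝᵏ)` (second derivatives). -/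
abbrev Lag (k : ℕ) :=
  (Fin k → ℝ) → (Fin 4 → Fin k → ℝ) → (Fin 4 → Fin 4 → Fin k → ℝ) → ℝ

/-- First-order part of the 2-jet of a field: `∂_μ Φ_a (x)`. -/
def jet1 {k : ℕ} (Φ : (Fin 4 → ℝ) → Fin k → ℝ) (x : Fin 4 → ℝ) : Fin 4 → Fin k → ℝ :=
  fun μ a => pd μ (fun y => Φ y a) x

/-- Second-order part of the 2-jet of a field: `∂_μ ∂_ν Φ_a (x)`. -/
def jet2 {k : ℕ} (Φ : (Fin 4 → ℝ) → Fin k → ℝ) (x : Fin 4 → ℝ) : Fin 4 → Fin 4 → Fin k → ℝ :=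
  fun μ ν a => pd μ (fun y => pd ν (fun z => Φ z a) y) x

/-- `L_a = ∂L/∂u_a`. -/
def Lu {k : ℕ} (L : Lag k) (a : Fin k) (u : Fin k → ℝ) (p : Fin 4 → Fin k → ℝ)
    (q : Fin 4 → Fin 4 → Fin k → ℝ) : ℝ :=
  fderiv ℝ (fun v => L v p q) u (Pi.single a 1)

/-- `L_a^μ = ∂L/∂p_{aμ}`. -/
def Lp {k : ℕ} (L : Lag k) (a : Fin k) (μ : Fin 4) (u : Fin k → ℝ) (p : Fin 4 → Fin k → ℝ)
    (q : Fin 4 → Fin 4 → Fin k → ℝ) : ℝ :=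
  fderiv ℝ (fun w => L u w q) p (Pi.single μ (Pi.single a 1))

/-- `L_a^{μν} = ∂L/∂q_{aμν}`. -/
def Lq {k : ℕ} (L : Lag k) (a : Fin k) (μ ν : Fin 4) (u : Fin k → ℝ) (p : Fin 4 → Fin k → ℝ)
    (q : Fin 4 → Fin 4 → Fin k → ℝ) : ℝ :=
  fderiv ℝ (fun w => L u p w) q (Pi.single μ (Pi.single ν (Pi.single a 1)))

/-- `L_a` evaluated at the 2-jet of `Φ` at `x`. -/
def LuΦ {k : ℕ} (L : Lag k) (Φ : (Fin 4 → ℝ) → Fin k → ℝ) (a : Fin k) (x : Fin 4 → ℝ) : ℝ :=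
  Lu L a (Φ x) (jet1 Φ x) (jet2 Φ x)

/-- `L_a^μ` evaluated at the 2-jet of `Φ` at `x`. -/
def LpΦ {k : ℕ} (L : Lag k) (Φ : (Fin 4 → ℝ) → Fin k → ℝ) (a : Fin k) (μ : Fin 4)
    (x : Fin 4 → ℝ) : ℝ :=
  Lp L a μ (Φ x) (jet1 Φ x) (jet2 Φ x)

/-- `L_a^{μν}` evaluated at the 2-jet of `Φ` at `x`. -/
def LqΦ {k : ℕ} (L : Lag k) (Φ : (Fin 4 → ℝ) → Fin k → ℝ) (a : Fin k) (μ ν : Fin 4)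
    (x : Fin 4 → ℝ) : ℝ :=
  Lq L a μ ν (Φ x) (jet1 Φ x) (jet2 Φ x)

/-- The Lagrangian density `Λ(x)`: `L` evaluated at the 2-jet of `Φ` at `x`. -/
def Lval {k : ℕ} (L : Lag k) (Φ : (Fin 4 → ℝ) → Fin k → ℝ) (x : Fin 4 → ℝ) : ℝ :=
  L (Φ x) (jet1 Φ x) (jet2 Φ x)

/-- The Euler–Lagrange expression `E_a = L_a - ∑_μ ∂_μ L_a^μ + ∑_{μ,ν} ∂_μ ∂_ν L_a^{μν}`. -/
def EL {k : ℕ} (L : Lag k) (Φ : (Fin 4 → ℝ) → Fin k → ℝ) (a : Fin k) (x : Fin 4 → ℝ) : ℝ :=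
  LuΦ L Φ a x - ∑ μ, pd μ (LpΦ L Φ a μ) x
    + ∑ μ, ∑ ν, pd μ (fun y => pd ν (LqΦ L Φ a μ ν) y) x

theorem contDiff_pd {f : (Fin 4 → ℝ) → ℝ} (hf : ContDiff ℝ (⊤ : ℕ∞) f) (μ : Fin 4) :
    ContDiff ℝ (⊤ : ℕ∞) (pd μ f) :=
  (hf.fderiv_right (m := (⊤ : ℕ∞)) (by simp)).clm_apply contDiff_const

theorem ContDiff.differentiableAt_top {E F : Type*} [NormedAddCommGroup E] [NormedSpace ℝ E]
    [NormedAddCommGroup F] [NormedSpace ℝ F] {f : E → F} (hf : ContDiff ℝ (⊤ : ℕ∞) f) (x : E) :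
    DifferentiableAt ℝ f x :=
  hf.differentiable (by simp) x

theorem pd_add {f g : (Fin 4 → ℝ) → ℝ} (hf : ContDiff ℝ (⊤ : ℕ∞) f)
    (hg : ContDiff ℝ (⊤ : ℕ∞) g) (μ : Fin 4) (x : Fin 4 → ℝ) :
    pd μ (fun y => f y + g y) x = pd μ f x + pd μ g x := by
  simp only [pd]
  rw [fderiv_fun_add (hf.differentiableAt_top x) (hg.differentiableAt_top x)]
  rfl

theorem pd_sub {f g : (Fin 4 → ℝ) → ℝ} (hf : ContDiff ℝ (⊤ : ℕ∞) f)
    (hg : ContDiff ℝ (⊤ : ℕ∞) g) (μ : Fin 4) (x : Fin 4 → ℝ) :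
    pd μ (fun y => f y - g y) x = pd μ f x - pd μ g x := by
  simp only [pd]
  rw [fderiv_fun_sub (hf.differentiableAt_top x) (hg.differentiableAt_top x)]
  rfl

theorem pd_mul {f g : (Fin 4 → ℝ) → ℝ} (hf : ContDiff ℝ (⊤ : ℕ∞) f)
    (hg : ContDiff ℝ (⊤ : ℕ∞) g) (μ : Fin 4) (x : Fin 4 → ℝ) :
    pd μ (fun y => f y * g y) x = pd μ f x * g x + f x * pd μ g x := by
  simp only [pd]
  rw [fderiv_fun_mul (hf.differentiableAt_top x) (hg.differentiableAt_top x)]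
  simp
  ring

theorem pd_sum {ι : Type*} [Fintype ι] {f : ι → (Fin 4 → ℝ) → ℝ}
    (hf : ∀ i, ContDiff ℝ (⊤ : ℕ∞) (f i)) (μ : Fin 4) (x : Fin 4 → ℝ) :
    pd μ (fun y => ∑ i, f i y) x = ∑ i, pd μ (f i) x := by
  simp only [pd]
  rw [fderiv_fun_sum fun i _ => (hf i).differentiableAt_top x]
  simp

theorem pd_comm {f : (Fin 4 → ℝ) → ℝ} (hf : ContDiff ℝ (⊤ : ℕ∞) f) (μ ν : Fin 4)
    (x : Fin 4 → ℝ) : pd μ (pd ν f) x = pd ν (pd μ f) x := by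
  have key : ∀ α β : Fin 4, pd α (pd β f) x
      = fderiv ℝ (fderiv ℝ f) x (Pi.single α 1) (Pi.single β 1) := by
    intro α β
    have h : DifferentiableAt ℝ (fderiv ℝ f) x :=
      (hf.fderiv_right (m := (⊤ : ℕ∞)) (by simp)).differentiableAt_top x
    change fderiv ℝ (fun y => fderiv ℝ f y (Pi.single β 1)) x (Pi.single α 1) = _
    rw [fderiv_clm_apply h (differentiableAt_const _)]
    simp
  have h2 : minSmoothness ℝ 2 ≤ ((⊤ : ℕ∞) : WithTop ℕ∞) := by
    rw [minSmoothness_of_isRCLikeNormedField]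
    exact WithTop.coe_le_coe.2 (le_top (a := (2 : ℕ∞)))
  rw [key, key]
  exact (hf.contDiffAt.isSymmSndFDerivAt h2).eq _ _

theorem ContinuousLinearMap.apply_eq_sum_single {ι E : Type*} [Fintype ι] [DecidableEq ι]
    [NormedAddCommGroup E] [NormedSpace ℝ E] (A : (ι → E) →L[ℝ] ℝ) (w : ι → E) :
    A w = ∑ i, A (Pi.single i (w i)) := by
  rw [← map_sum, Finset.univ_sum_single]

theorem ContinuousLinearMap.apply_eq_sum_mul {ι : Type*} [Fintype ι] [DecidableEq ι]
    (A : (ι → ℝ) →L[ℝ] ℝ) (w : ι → ℝ) :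
    A w = ∑ i, A (Pi.single i 1) * w i := by
  rw [A.apply_eq_sum_single]
  refine Finset.sum_congr rfl fun i _ => ?_
  have h : (Pi.single i (w i) : ι → ℝ) = w i • Pi.single i 1 := by
    rw [← Pi.single_smul]; simp
  rw [h, map_smul, smul_eq_mul, mul_comm]

theorem ContinuousLinearMap.apply_eq_sum_single_mul {ι κ : Type*} [Fintype ι] [DecidableEq ι]
    [Fintype κ] [DecidableEq κ] (A : (ι → κ → ℝ) →L[ℝ] ℝ) (w : ι → κ → ℝ) :
    A w = ∑ i, ∑ j, A (Pi.single i (Pi.single j 1)) * w i j := by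
  rw [A.apply_eq_sum_single]
  exact Finset.sum_congr rfl fun i _ =>
    (A.comp (ContinuousLinearMap.single ℝ (fun _ => κ → ℝ) i)).apply_eq_sum_mul (w i)

section Jet

variable {k : ℕ} {L : Lag k} {Φ : (Fin 4 → ℝ) → Fin k → ℝ}

/-- The Lagrangian as a function of a single variable in the 2-jet space. -/
def Lag.uncurry (L : Lag k)
    (z : (Fin k → ℝ) × (Fin 4 → Fin k → ℝ) × (Fin 4 → Fin 4 → Fin k → ℝ)) : ℝ :=
  L z.1 z.2.1 z.2.2

/-- The 2-jet of a field. -/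
def jet (Φ : (Fin 4 → ℝ) → Fin k → ℝ) (x : Fin 4 → ℝ) :
    (Fin k → ℝ) × (Fin 4 → Fin k → ℝ) × (Fin 4 → Fin 4 → Fin k → ℝ) :=
  (Φ x, jet1 Φ x, jet2 Φ x)

theorem contDiff_jet1_apply (hΦ : ContDiff ℝ (⊤ : ℕ∞) Φ) (μ : Fin 4) (a : Fin k) :
    ContDiff ℝ (⊤ : ℕ∞) (fun x => jet1 Φ x μ a) :=
  contDiff_pd (contDiff_pi.1 hΦ a) μ

theorem contDiff_jet2_apply (hΦ : ContDiff ℝ (⊤ : ℕ∞) Φ) (μ ν : Fin 4) (a : Fin k) :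
    ContDiff ℝ (⊤ : ℕ∞) (fun x => jet2 Φ x μ ν a) :=
  contDiff_pd (contDiff_jet1_apply hΦ ν a) μ

theorem contDiff_jet1 (hΦ : ContDiff ℝ (⊤ : ℕ∞) Φ) : ContDiff ℝ (⊤ : ℕ∞) (jet1 Φ) :=
  contDiff_pi.2 fun μ => contDiff_pi.2 fun a => contDiff_jet1_apply hΦ μ a

theorem contDiff_jet2 (hΦ : ContDiff ℝ (⊤ : ℕ∞) Φ) : ContDiff ℝ (⊤ : ℕ∞) (jet2 Φ) :=
  contDiff_pi.2 fun μ => contDiff_pi.2 fun ν => contDiff_pi.2 fun a =>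
    contDiff_jet2_apply hΦ μ ν a

theorem contDiff_jet (hΦ : ContDiff ℝ (⊤ : ℕ∞) Φ) : ContDiff ℝ (⊤ : ℕ∞) (jet Φ) :=
  hΦ.prodMk ((contDiff_jet1 hΦ).prodMk (contDiff_jet2 hΦ))

theorem jet2_comm (hΦ : ContDiff ℝ (⊤ : ℕ∞) Φ) (x : Fin 4 → ℝ) (μ ν : Fin 4) (a : Fin k) :
    jet2 Φ x μ ν a = jet2 Φ x ν μ a :=
  pd_comm (contDiff_pi.1 hΦ a) μ ν x

theorem pd_jet2_comm (hΦ : ContDiff ℝ (⊤ : ℕ∞) Φ) (x : Fin 4 → ℝ) (μ ν σ : Fin 4)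
    (a : Fin k) :
    pd μ (fun y => jet2 Φ y ν σ a) x = pd σ (fun y => jet2 Φ y μ ν a) x := by
  have h : (fun y => jet2 Φ y ν σ a) = fun y => jet2 Φ y σ ν a :=
    funext fun y => jet2_comm hΦ y ν σ a
  rw [h]
  exact pd_comm (contDiff_jet1_apply hΦ ν a) μ σ x

theorem fderiv_uncurry_fst (hL : ContDiff ℝ (⊤ : ℕ∞) L.uncurry) (u p q) (v : Fin k → ℝ) :
    fderiv ℝ (fun w => L w p q) u v = fderiv ℝ L.uncurry (u, p, q) (v, 0, 0) := by
  have h := HasFDerivAt.comp (g := L.uncurry) (f := fun w => (w, p, q)) u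
    (hL.differentiableAt_top (u, p, q)).hasFDerivAt
    ((hasFDerivAt_id u).prodMk (hasFDerivAt_const (p, q) u))
  exact congrArg (fun A => A v) h.fderiv

theorem fderiv_uncurry_snd (hL : ContDiff ℝ (⊤ : ℕ∞) L.uncurry) (u p q)
    (v : Fin 4 → Fin k → ℝ) :
    fderiv ℝ (fun w => L u w q) p v = fderiv ℝ L.uncurry (u, p, q) (0, v, 0) := by
  have h := HasFDerivAt.comp (g := L.uncurry) (f := fun w => (u, w, q)) p
    (hL.differentiableAt_top (u, p, q)).hasFDerivAt
    ((hasFDerivAt_const u p).prodMk ((hasFDerivAt_id p).prodMk (hasFDerivAt_const q p)))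
  exact congrArg (fun A => A v) h.fderiv

theorem fderiv_uncurry_trd (hL : ContDiff ℝ (⊤ : ℕ∞) L.uncurry) (u p q)
    (v : Fin 4 → Fin 4 → Fin k → ℝ) :
    fderiv ℝ (fun w => L u p w) q v = fderiv ℝ L.uncurry (u, p, q) (0, 0, v) := by
  have h := HasFDerivAt.comp (g := L.uncurry) (f := fun w => (u, p, w)) q
    (hL.differentiableAt_top (u, p, q)).hasFDerivAt
    ((hasFDerivAt_const u q).prodMk ((hasFDerivAt_const p q).prodMk (hasFDerivAt_id q)))
  exact congrArg (fun A => A v) h.fderiv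

theorem contDiff_fderiv_uncurry_jet (hL : ContDiff ℝ (⊤ : ℕ∞) L.uncurry)
    (hΦ : ContDiff ℝ (⊤ : ℕ∞) Φ) (v) :
    ContDiff ℝ (⊤ : ℕ∞) (fun x => fderiv ℝ L.uncurry (jet Φ x) v) :=
  ((hL.fderiv_right (m := (⊤ : ℕ∞)) (by simp)).comp (contDiff_jet hΦ)).clm_apply contDiff_const

theorem contDiff_LpΦ (hL : ContDiff ℝ (⊤ : ℕ∞) L.uncurry) (hΦ : ContDiff ℝ (⊤ : ℕ∞) Φ)
    (a : Fin k) (μ : Fin 4) : ContDiff ℝ (⊤ : ℕ∞) (LpΦ L Φ a μ) := by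
  have h : LpΦ L Φ a μ = fun x =>
      fderiv ℝ L.uncurry (jet Φ x) (0, Pi.single μ (Pi.single a 1), 0) :=
    funext fun _ => fderiv_uncurry_snd hL _ _ _ _
  exact h ▸ contDiff_fderiv_uncurry_jet hL hΦ _

theorem contDiff_LqΦ (hL : ContDiff ℝ (⊤ : ℕ∞) L.uncurry) (hΦ : ContDiff ℝ (⊤ : ℕ∞) Φ)
    (a : Fin k) (μ ν : Fin 4) : ContDiff ℝ (⊤ : ℕ∞) (LqΦ L Φ a μ ν) := by
  have h : LqΦ L Φ a μ ν = fun x =>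
      fderiv ℝ L.uncurry (jet Φ x) (0, 0, Pi.single μ (Pi.single ν (Pi.single a 1))) :=
    funext fun _ => fderiv_uncurry_trd hL _ _ _ _
  exact h ▸ contDiff_fderiv_uncurry_jet hL hΦ _

theorem contDiff_Lval (hL : ContDiff ℝ (⊤ : ℕ∞) L.uncurry) (hΦ : ContDiff ℝ (⊤ : ℕ∞) Φ) :
    ContDiff ℝ (⊤ : ℕ∞) (Lval L Φ) :=
  hL.comp (contDiff_jet hΦ)

/-- Chain rule for the Lagrangian density along the 2-jet of a field. -/
theorem pd_Lval (hL : ContDiff ℝ (⊤ : ℕ∞) L.uncurry) (hΦ : ContDiff ℝ (⊤ : ℕ∞) Φ)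
    (σ : Fin 4) (x : Fin 4 → ℝ) :
    pd σ (Lval L Φ) x = ∑ a, (LuΦ L Φ a x * jet1 Φ x σ a
      + ∑ μ, LpΦ L Φ a μ x * jet2 Φ x σ μ a
      + ∑ μ, ∑ ν, LqΦ L Φ a μ ν x * pd σ (fun y => jet2 Φ y μ ν a) x) := by
  set e : Fin 4 → ℝ := Pi.single σ 1 with he
  have h0 := (hΦ.differentiableAt_top x).hasFDerivAt
  have h1 := ((contDiff_jet1 hΦ).differentiableAt_top x).hasFDerivAt
  have h2 := ((contDiff_jet2 hΦ).differentiableAt_top x).hasFDerivAt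
  have hchain := (hL.differentiableAt_top (jet Φ x)).hasFDerivAt.comp x
    (h0.prodMk (h1.prodMk h2))
  have hsplit : pd σ (Lval L Φ) x
      = fderiv ℝ (fun w => L w (jet1 Φ x) (jet2 Φ x)) (Φ x) (fderiv ℝ Φ x e)
        + fderiv ℝ (fun w => L (Φ x) w (jet2 Φ x)) (jet1 Φ x) (fderiv ℝ (jet1 Φ) x e)
        + fderiv ℝ (fun w => L (Φ x) (jet1 Φ x) w) (jet2 Φ x) (fderiv ℝ (jet2 Φ) x e) := by
    rw [fderiv_uncurry_fst hL, fderiv_uncurry_snd hL, fderiv_uncurry_trd hL, ← map_add,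
      ← map_add]
    refine (congrArg (fun A => A e) hchain.fderiv).trans ?_
    simp [jet]
  have c0 : ∀ a, fderiv ℝ Φ x e a = jet1 Φ x σ a := fun a =>
    (congrArg (fun A => A e) (hasFDerivAt_pi'.1 h0 a).fderiv).symm
  have c1 : ∀ μ a, fderiv ℝ (jet1 Φ) x e μ a = jet2 Φ x σ μ a := fun μ a =>
    (congrArg (fun A => A e) (hasFDerivAt_pi'.1 (hasFDerivAt_pi'.1 h1 μ) a).fderiv).symm
  have c2 : ∀ μ ν a, fderiv ℝ (jet2 Φ) x e μ ν a = pd σ (fun y => jet2 Φ y μ ν a) x :=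
    fun μ ν a => (congrArg (fun A => A e)
      (hasFDerivAt_pi'.1 (hasFDerivAt_pi'.1 (hasFDerivAt_pi'.1 h2 μ) ν) a).fderiv).symm
  rw [hsplit, ContinuousLinearMap.apply_eq_sum_mul,
    ContinuousLinearMap.apply_eq_sum_single_mul, ContinuousLinearMap.apply_eq_sum_single]
  have h3 : ∀ μ, fderiv ℝ (fun w => L (Φ x) (jet1 Φ x) w) (jet2 Φ x)
      (Pi.single μ (fderiv ℝ (jet2 Φ) x e μ))
      = ∑ ν, ∑ a, LqΦ L Φ a μ ν x * pd σ (fun y => jet2 Φ y μ ν a) x := fun μ => by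
    refine (((fderiv ℝ (fun w => L (Φ x) (jet1 Φ x) w) (jet2 Φ x)).comp
      (ContinuousLinearMap.single ℝ (fun _ => Fin 4 → Fin k → ℝ) μ)).apply_eq_sum_single_mul
        _).trans ?_
    simp only [c2]
    rfl
  simp only [h3, c0, c1, Finset.sum_add_distrib]
  congr 1
  · congr 1
    exact Finset.sum_comm
  · rw [Finset.sum_comm]
    conv_rhs => rw [Finset.sum_comm]; enter [2, μ]; rw [Finset.sum_comm]
    exact Finset.sum_comm

end Jet

/-- Divergence of the part of the Noether current carried by a field variation `W`. -/
theorem sum_pd_current {P : Fin 4 → (Fin 4 → ℝ) → ℝ} {Q : Fin 4 → Fin 4 → (Fin 4 → ℝ) → ℝ}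
    {W : (Fin 4 → ℝ) → ℝ} (hP : ∀ μ, ContDiff ℝ (⊤ : ℕ∞) (P μ))
    (hQ : ∀ μ ν, ContDiff ℝ (⊤ : ℕ∞) (Q μ ν)) (hW : ContDiff ℝ (⊤ : ℕ∞) W)
    (hsymm : ∀ μ ν, Q μ ν = Q ν μ) (x : Fin 4 → ℝ) :
    ∑ μ, (pd μ (fun y => (P μ y - ∑ ν, pd ν (Q μ ν) y) * W y) x
        + pd μ (fun y => ∑ ν, Q μ ν y * pd ν W y) x)
      = (∑ μ, pd μ (P μ) x - ∑ μ, ∑ ν, pd μ (pd ν (Q μ ν)) x) * W x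
        + ∑ μ, P μ x * pd μ W x + ∑ μ, ∑ ν, Q μ ν x * pd μ (pd ν W) x := by
  have hS : ∀ μ, ContDiff ℝ (⊤ : ℕ∞) (fun y => ∑ ν, pd ν (Q μ ν) y) := fun μ =>
    ContDiff.sum fun ν _ => contDiff_pd (hQ μ ν) ν
  have hcross : ∑ μ, (∑ ν, pd ν (Q μ ν) x) * pd μ W x
      = ∑ μ, ∑ ν, pd μ (Q μ ν) x * pd ν W x := by
    simp only [Finset.sum_mul]
    rw [Finset.sum_comm]
    exact Finset.sum_congr rfl fun μ _ => Finset.sum_congr rfl fun ν _ => by rw [hsymm ν μ]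
  have hterm : ∀ μ, pd μ (fun y => (P μ y - ∑ ν, pd ν (Q μ ν) y) * W y) x
        + pd μ (fun y => ∑ ν, Q μ ν y * pd ν W y) x
      = (pd μ (P μ) x - ∑ ν, pd μ (pd ν (Q μ ν)) x) * W x
        + (P μ x * pd μ W x - (∑ ν, pd ν (Q μ ν) x) * pd μ W x)
        + (∑ ν, pd μ (Q μ ν) x * pd ν W x + ∑ ν, Q μ ν x * pd μ (pd ν W) x) := by
    intro μ
    rw [pd_mul ((hP μ).sub (hS μ)) hW, pd_sub (hP μ) (hS μ),
      pd_sum fun ν => contDiff_pd (hQ μ ν) ν,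
      pd_sum fun ν => (hQ μ ν).mul (contDiff_pd hW ν), ← Finset.sum_add_distrib]
    simp only [fun ν => pd_mul (hQ μ ν) (contDiff_pd hW ν) μ x]
    ring
  simp only [hterm, Finset.sum_add_distrib, Finset.sum_sub_distrib, ← Finset.sum_mul, hcross]
  ring

section Variation

variable {k : ℕ} {Φ Ψ : (Fin 4 → ℝ) → Fin k → ℝ} {X : (Fin 4 → ℝ) → Fin 4 → ℝ}

/-- The vertical (characteristic) variation `W_a = Ψ_a - ∑_σ ∂_σ Φ_a X^σ`. -/
def verticalVariation (Φ Ψ : (Fin 4 → ℝ) → Fin k → ℝ) (X : (Fin 4 → ℝ) → Fin 4 → ℝ)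
    (a : Fin k) (x : Fin 4 → ℝ) : ℝ :=
  Ψ x a - ∑ σ, jet1 Φ x σ a * X x σ

theorem contDiff_verticalVariation (hΦ : ContDiff ℝ (⊤ : ℕ∞) Φ) (hΨ : ContDiff ℝ (⊤ : ℕ∞) Ψ)
    (hX : ContDiff ℝ (⊤ : ℕ∞) X) (a : Fin k) :
    ContDiff ℝ (⊤ : ℕ∞) (verticalVariation Φ Ψ X a) :=
  (contDiff_pi.1 hΨ a).sub
    (ContDiff.sum fun σ _ => (contDiff_jet1_apply hΦ σ a).mul (contDiff_pi.1 hX σ))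

theorem pd_verticalVariation (hΦ : ContDiff ℝ (⊤ : ℕ∞) Φ) (hΨ : ContDiff ℝ (⊤ : ℕ∞) Ψ)
    (hX : ContDiff ℝ (⊤ : ℕ∞) X) (a : Fin k) (μ : Fin 4) (x : Fin 4 → ℝ) :
    pd μ (verticalVariation Φ Ψ X a) x = pd μ (fun y => Ψ y a) x
      - ∑ σ, (jet2 Φ x μ σ a * X x σ + jet1 Φ x σ a * pd μ (fun y => X y σ) x) := by
  have hJX : ∀ σ, ContDiff ℝ (⊤ : ℕ∞) (fun y => jet1 Φ y σ a * X y σ) := fun σ =>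
    (contDiff_jet1_apply hΦ σ a).mul (contDiff_pi.1 hX σ)
  refine (pd_sub (contDiff_pi.1 hΨ a) (ContDiff.sum fun σ _ => hJX σ) μ x).trans ?_
  rw [pd_sum hJX]
  simp only [fun σ => pd_mul (contDiff_jet1_apply hΦ σ a) (contDiff_pi.1 hX σ) μ x]
  rfl

theorem pd_pd_verticalVariation (hΦ : ContDiff ℝ (⊤ : ℕ∞) Φ) (hΨ : ContDiff ℝ (⊤ : ℕ∞) Ψ)
    (hX : ContDiff ℝ (⊤ : ℕ∞) X) (a : Fin k) (μ ν : Fin 4) (x : Fin 4 → ℝ) :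
    pd μ (pd ν (verticalVariation Φ Ψ X a)) x = pd μ (pd ν (fun y => Ψ y a)) x
      - ∑ σ, (pd μ (fun y => jet2 Φ y ν σ a) x * X x σ
        + jet2 Φ x ν σ a * pd μ (fun y => X y σ) x
        + jet2 Φ x μ σ a * pd ν (fun y => X y σ) x
        + jet1 Φ x σ a * pd μ (pd ν (fun y => X y σ)) x) := by
  have hXσ := contDiff_pi.1 hX
  have h1 : ∀ σ, ContDiff ℝ (⊤ : ℕ∞) (fun y => jet2 Φ y ν σ a * X y σ) := fun σ =>
    (contDiff_jet2_apply hΦ ν σ a).mul (hXσ σ)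
  have h2 : ∀ σ, ContDiff ℝ (⊤ : ℕ∞) (fun y => jet1 Φ y σ a * pd ν (fun z => X z σ) y) :=
    fun σ => (contDiff_jet1_apply hΦ σ a).mul (contDiff_pd (hXσ σ) ν)
  rw [funext fun y => pd_verticalVariation hΦ hΨ hX a ν y]
  rw [pd_sub (contDiff_pd (contDiff_pi.1 hΨ a) ν) (ContDiff.sum fun σ _ => (h1 σ).add (h2 σ)),
    pd_sum fun σ => (h1 σ).add (h2 σ)]
  refine congrArg₂ _ rfl (Finset.sum_congr rfl fun σ _ => ?_)
  rw [pd_add (h1 σ) (h2 σ), pd_mul (contDiff_jet2_apply hΦ ν σ a) (hXσ σ),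
    pd_mul (contDiff_jet1_apply hΦ σ a) (contDiff_pd (hXσ σ) ν)]
  change _ + (jet2 Φ x μ σ a * _ + _) = _
  ring

theorem pd_variation_eq (hΦ : ContDiff ℝ (⊤ : ℕ∞) Φ) (hΨ : ContDiff ℝ (⊤ : ℕ∞) Ψ)
    (hX : ContDiff ℝ (⊤ : ℕ∞) X) (a : Fin k) (μ : Fin 4) (x : Fin 4 → ℝ) :
    pd μ (fun y => Ψ y a) x - ∑ σ, jet1 Φ x σ a * pd μ (fun y => X y σ) x
      = pd μ (verticalVariation Φ Ψ X a) x + ∑ σ, jet2 Φ x σ μ a * X x σ := by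
  rw [pd_verticalVariation hΦ hΨ hX, Finset.sum_add_distrib]
  simp only [fun σ => jet2_comm hΦ x μ σ a]
  ring

theorem pd_pd_variation_eq (hΦ : ContDiff ℝ (⊤ : ℕ∞) Φ) (hΨ : ContDiff ℝ (⊤ : ℕ∞) Ψ)
    (hX : ContDiff ℝ (⊤ : ℕ∞) X) (a : Fin k) (μ ν : Fin 4) (x : Fin 4 → ℝ) :
    pd μ (fun y => pd ν (fun z => Ψ z a) y) x
        - ∑ σ, (jet2 Φ x σ ν a * pd μ (fun y => X y σ) x
          + jet2 Φ x σ μ a * pd ν (fun y => X y σ) x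
          + jet1 Φ x σ a * pd μ (fun y => pd ν (fun z => X z σ) y) x)
      = pd μ (pd ν (verticalVariation Φ Ψ X a)) x
        + ∑ σ, pd σ (fun y => jet2 Φ y μ ν a) x * X x σ := by
  rw [pd_pd_verticalVariation hΦ hΨ hX]
  simp only [Finset.sum_add_distrib, fun σ => pd_jet2_comm hΦ x μ ν σ a,
    fun σ => jet2_comm hΦ x ν σ a, fun σ => jet2_comm hΦ x μ σ a]
  ring

end Variation

/-- **Noether's theorem for a second-order Lagrangian** (paper's Theorem 1, eqns (22)–(28)).
If `Φ` satisfies the Euler–Lagrange equations and the infinitesimal invariance identity holds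
for the coordinate variation `δx = X` and field variation `δΦ = Ψ`, then the Noether current
`j^μ = Λ X^μ + ∑_a (L_a^μ - ∑_ν ∂_ν L_a^{μν}) W_a + ∑_{a,ν} L_a^{μν} ∂_ν W_a`,
with `W_a = Ψ_a - ∑_σ ∂_σ Φ_a X^σ`, is divergence free. -/
theorem noether_theorem_second_order
    (k : ℕ) (L : Lag k)
    (hL : ContDiff ℝ (⊤ : ℕ∞) (fun z : (Fin k → ℝ) × (Fin 4 → Fin k → ℝ) × (Fin 4 → Fin 4 → Fin k → ℝ) =>
      L z.1 z.2.1 z.2.2))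
    (hLsym : ∀ (a : Fin k) (μ ν : Fin 4) (u : Fin k → ℝ) (p : Fin 4 → Fin k → ℝ)
      (q : Fin 4 → Fin 4 → Fin k → ℝ), Lq L a μ ν u p q = Lq L a ν μ u p q)
    (Φ : (Fin 4 → ℝ) → Fin k → ℝ) (hΦ : ContDiff ℝ (⊤ : ℕ∞) Φ)
    (hEL : ∀ (a : Fin k) (x : Fin 4 → ℝ), EL L Φ a x = 0)
    (X : (Fin 4 → ℝ) → Fin 4 → ℝ) (hX : ContDiff ℝ (⊤ : ℕ∞) X)
    (Ψ : (Fin 4 → ℝ) → Fin k → ℝ) (hΨ : ContDiff ℝ (⊤ : ℕ∞) Ψ)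
    (hinv : ∀ x : Fin 4 → ℝ,
      (∑ a, (LuΦ L Φ a x * Ψ x a
        + ∑ μ, LpΦ L Φ a μ x *
            (pd μ (fun y => Ψ y a) x - ∑ σ, jet1 Φ x σ a * pd μ (fun y => X y σ) x)
        + ∑ μ, ∑ ν, LqΦ L Φ a μ ν x *
            (pd μ (fun y => pd ν (fun z => Ψ z a) y) x
              - ∑ σ, (jet2 Φ x σ ν a * pd μ (fun y => X y σ) x
                    + jet2 Φ x σ μ a * pd ν (fun y => X y σ) x
                    + jet1 Φ x σ a * pd μ (fun y => pd ν (fun z => X z σ) y) x))))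
        + Lval L Φ x * ∑ σ, pd σ (fun y => X y σ) x = 0) :
    ∀ x : Fin 4 → ℝ,
      ∑ μ, pd μ (fun y =>
        Lval L Φ y * X y μ
        + ∑ a, (LpΦ L Φ a μ y - ∑ ν, pd ν (LqΦ L Φ a μ ν) y) *
            (Ψ y a - ∑ σ, jet1 Φ y σ a * X y σ)
        + ∑ a, ∑ ν, LqΦ L Φ a μ ν y *
            pd ν (fun z => Ψ z a - ∑ σ, jet1 Φ z σ a * X z σ) y) x = 0 := by
  intro x
  have hXσ := contDiff_pi.1 hX
  have hΛ : ContDiff ℝ (⊤ : ℕ∞) (Lval L Φ) := contDiff_Lval hL hΦ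
  have hP := contDiff_LpΦ (L := L) hL hΦ
  have hQ := contDiff_LqΦ (L := L) hL hΦ
  have hW := contDiff_verticalVariation hΦ hΨ hX
  have hA : ∀ μ a, ContDiff ℝ (⊤ : ℕ∞) (fun y =>
      (LpΦ L Φ a μ y - ∑ ν, pd ν (LqΦ L Φ a μ ν) y) * verticalVariation Φ Ψ X a y) :=
    fun μ a => ((hP a μ).sub (ContDiff.sum fun ν _ => contDiff_pd (hQ a μ ν) ν)).mul (hW a)
  have hB : ∀ μ a, ContDiff ℝ (⊤ : ℕ∞) (fun y =>
      ∑ ν, LqΦ L Φ a μ ν y * pd ν (verticalVariation Φ Ψ X a) y) :=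
    fun μ a => ContDiff.sum fun ν _ => (hQ a μ ν).mul (contDiff_pd (hW a) ν)
  change ∑ μ, pd μ (fun y => Lval L Φ y * X y μ
    + ∑ a, (LpΦ L Φ a μ y - ∑ ν, pd ν (LqΦ L Φ a μ ν) y) * verticalVariation Φ Ψ X a y
    + ∑ a, ∑ ν, LqΦ L Φ a μ ν y * pd ν (verticalVariation Φ Ψ X a) y) x = 0
  have hdiv : ∀ μ, pd μ (fun y => Lval L Φ y * X y μ
      + ∑ a, (LpΦ L Φ a μ y - ∑ ν, pd ν (LqΦ L Φ a μ ν) y) * verticalVariation Φ Ψ X a y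
      + ∑ a, ∑ ν, LqΦ L Φ a μ ν y * pd ν (verticalVariation Φ Ψ X a) y) x
      = pd μ (Lval L Φ) x * X x μ + Lval L Φ x * pd μ (fun y => X y μ) x
        + ∑ a, (pd μ (fun y => (LpΦ L Φ a μ y - ∑ ν, pd ν (LqΦ L Φ a μ ν) y)
            * verticalVariation Φ Ψ X a y) x
          + pd μ (fun y => ∑ ν, LqΦ L Φ a μ ν y * pd ν (verticalVariation Φ Ψ X a) y) x) := by
    intro μ
    rw [pd_add ((hΛ.mul (hXσ μ)).add (ContDiff.sum fun a _ => hA μ a))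
        (ContDiff.sum fun a _ => hB μ a),
      pd_add (hΛ.mul (hXσ μ)) (ContDiff.sum fun a _ => hA μ a), pd_mul hΛ (hXσ μ),
      pd_sum (hA μ), pd_sum (hB μ), Finset.sum_add_distrib, add_assoc]
  have hcur : ∀ a, ∑ μ, (pd μ (fun y => (LpΦ L Φ a μ y - ∑ ν, pd ν (LqΦ L Φ a μ ν) y)
            * verticalVariation Φ Ψ X a y) x
          + pd μ (fun y => ∑ ν, LqΦ L Φ a μ ν y * pd ν (verticalVariation Φ Ψ X a) y) x)
      = LuΦ L Φ a x * verticalVariation Φ Ψ X a x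
        + ∑ μ, LpΦ L Φ a μ x * pd μ (verticalVariation Φ Ψ X a) x
        + ∑ μ, ∑ ν, LqΦ L Φ a μ ν x * pd μ (pd ν (verticalVariation Φ Ψ X a)) x := by
    intro a
    have hEL' : LuΦ L Φ a x = ∑ μ, pd μ (LpΦ L Φ a μ) x
        - ∑ μ, ∑ ν, pd μ (pd ν (LqΦ L Φ a μ ν)) x := by
      have h : LuΦ L Φ a x - ∑ μ, pd μ (LpΦ L Φ a μ) x
        + ∑ μ, ∑ ν, pd μ (pd ν (LqΦ L Φ a μ ν)) x = 0 := hEL a x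
      linarith
    rw [sum_pd_current (hP a) (hQ a) (hW a)
      (fun μ ν => funext fun y => hLsym a μ ν _ _ _) x, hEL']
  have hinv_a : ∀ a, LuΦ L Φ a x * Ψ x a
        + ∑ μ, LpΦ L Φ a μ x * (pd μ (verticalVariation Φ Ψ X a) x
          + ∑ σ, jet2 Φ x σ μ a * X x σ)
        + ∑ μ, ∑ ν, LqΦ L Φ a μ ν x * (pd μ (pd ν (verticalVariation Φ Ψ X a)) x
          + ∑ σ, pd σ (fun y => jet2 Φ y μ ν a) x * X x σ)
      = (LuΦ L Φ a x * verticalVariation Φ Ψ X a x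
        + ∑ μ, LpΦ L Φ a μ x * pd μ (verticalVariation Φ Ψ X a) x
        + ∑ μ, ∑ ν, LqΦ L Φ a μ ν x * pd μ (pd ν (verticalVariation Φ Ψ X a)) x)
        + ∑ σ, (LuΦ L Φ a x * jet1 Φ x σ a
          + ∑ μ, LpΦ L Φ a μ x * jet2 Φ x σ μ a
          + ∑ μ, ∑ ν, LqΦ L Φ a μ ν x * pd σ (fun y => jet2 Φ y μ ν a) x) * X x σ := by
    intro a
    have h1 : ∑ σ, (∑ μ, LpΦ L Φ a μ x * jet2 Φ x σ μ a) * X x σ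
        = ∑ μ, LpΦ L Φ a μ x * ∑ σ, jet2 Φ x σ μ a * X x σ := by
      simp only [Finset.sum_mul, Finset.mul_sum, mul_assoc]
      exact Finset.sum_comm
    have h2 : ∑ σ, (∑ μ, ∑ ν, LqΦ L Φ a μ ν x * pd σ (fun y => jet2 Φ y μ ν a) x) * X x σ
        = ∑ μ, ∑ ν, LqΦ L Φ a μ ν x * ∑ σ, pd σ (fun y => jet2 Φ y μ ν a) x * X x σ := by
      simp only [Finset.sum_mul, Finset.mul_sum, mul_assoc]
      rw [Finset.sum_comm]
      exact Finset.sum_congr rfl fun μ _ => Finset.sum_comm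
    have h0 : ∑ σ, LuΦ L Φ a x * jet1 Φ x σ a * X x σ
        = LuΦ L Φ a x * ∑ σ, jet1 Φ x σ a * X x σ := by
      simp only [Finset.mul_sum, mul_assoc]
    simp only [add_mul, mul_add, Finset.sum_add_distrib, h0, h1, h2, verticalVariation]
    ring
  have hx := hinv x
  simp only [pd_variation_eq hΦ hΨ hX, pd_pd_variation_eq hΦ hΨ hX, hinv_a] at hx
  rw [Finset.sum_add_distrib] at hx
  have hLX : ∑ σ, pd σ (Lval L Φ) x * X x σ = ∑ a, ∑ σ, (LuΦ L Φ a x * jet1 Φ x σ a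
          + ∑ μ, LpΦ L Φ a μ x * jet2 Φ x σ μ a
          + ∑ μ, ∑ ν, LqΦ L Φ a μ ν x * pd σ (fun y => jet2 Φ y μ ν a) x) * X x σ := by
    rw [Finset.sum_comm]
    exact Finset.sum_congr rfl fun σ _ => by rw [pd_Lval hL hΦ, Finset.sum_mul]
  rw [← hLX] at hx
  simp only [hdiv]
  rw [Finset.sum_add_distrib, Finset.sum_add_distrib, Finset.sum_comm (f := fun μ a => _ + _)]
  simp only [hcur, ← Finset.mul_sum]
  linarith

end
end

section
/- Let t₁ ≤ t₂ be real numbers. Let ρ : ℝ × (Fin 3 → ℝ) → ℝ and j : ℝ × (Fin 3 → ℝ) → (Fin 3 → ℝ) be continuously differentiable and satisfy the continuity equation ∂_t ρ(t, x) + ∑_{i} ∂_{x_i} j_i(t, x) = 0 for all (t, x). Suppose there exists R > 0 such that ρ(t, x) = 0 and j(t, x) = 0 whenever t ∈ [t₁, t₂] and ‖x‖ ≥ R. Then ∫_{ℝ³} ρ(t₁, x) dx = ∫_{ℝ³} ρ(t₂, x) dx. -/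
open MeasureTheory

/-- The continuous linear map splitting a point of `ℝⁿ⁺¹` into its first coordinate and the rest. -/
noncomputable def splitFirst (n : ℕ) : (Fin (n + 1) → ℝ) →L[ℝ] ℝ × (Fin n → ℝ) :=
  (ContinuousLinearMap.proj 0).prod (ContinuousLinearMap.pi fun i => ContinuousLinearMap.proj i.succ)

theorem splitFirst_apply {n : ℕ} (y : Fin (n + 1) → ℝ) :
    splitFirst n y = (y 0, fun i => y i.succ) := rfl

theorem splitFirst_single_zero (n : ℕ) : splitFirst n (Pi.single 0 1) = (1, 0) := by
  rw [splitFirst_apply]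
  ext i <;> simp

theorem splitFirst_single_succ {n : ℕ} (k : Fin n) :
    splitFirst n (Pi.single k.succ 1) = (0, Pi.single k 1) := by
  rw [splitFirst_apply]
  ext i
  · simp
  · simp [Pi.single_apply]

/-- A function on `ℝⁿ` vanishing outside a sup-norm ball has its integral given by the integral
over the corresponding box. -/
theorem setIntegral_Icc_eq_integral_of_forall_norm_ge {n : ℕ} {f : (Fin n → ℝ) → ℝ} {R : ℝ}
    (hR : 0 < R) (hf : ∀ x, R ≤ ‖x‖ → f x = 0) :
    ∫ x in Set.Icc (fun _ => -R) (fun _ => R), f x = ∫ x, f x := by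
  refine setIntegral_eq_integral_of_forall_compl_eq_zero fun x hx => hf x ?_
  contrapose! hx
  have h := (pi_norm_lt_iff hR).1 hx
  exact ⟨fun i => (abs_lt.1 (h i)).1.le, fun i => (abs_lt.1 (h i)).2.le⟩

/-- Conservation of the total charge in `n` space dimensions, for a `C¹` current which is
divergence free and vanishes outside a ball during the time interval `[t₁, t₂]`. -/
theorem integral_eq_of_divergence_free {n : ℕ} {t₁ t₂ R : ℝ} (ht : t₁ ≤ t₂) (hR : 0 < R)
    {ρ : ℝ × (Fin n → ℝ) → ℝ} {j : ℝ × (Fin n → ℝ) → Fin n → ℝ}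
    (hρ : ContDiff ℝ 1 ρ) (hj : ContDiff ℝ 1 j)
    (hcont : ∀ p : ℝ × (Fin n → ℝ),
      fderiv ℝ ρ p (1, 0) + ∑ i, fderiv ℝ (fun q => j q i) p (0, Pi.single i 1) = 0)
    (hsupp : ∀ (t : ℝ) (x : Fin n → ℝ),
      t ∈ Set.Icc t₁ t₂ → R ≤ ‖x‖ → ρ (t, x) = 0 ∧ j (t, x) = 0) :
    ∫ x : Fin n → ℝ, ρ (t₁, x) = ∫ x : Fin n → ℝ, ρ (t₂, x) := by
  have hji : ∀ i, ContDiff ℝ 1 fun q => j q i := contDiff_pi.1 hj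
  let F : Fin (n + 1) → ℝ × (Fin n → ℝ) → ℝ := Fin.cons ρ fun i q => j q i
  have hF : ∀ i, ContDiff ℝ 1 (F i) := Fin.cases hρ hji
  have hdiv : ∀ y : Fin (n + 1) → ℝ, ∑ i,
      ((fderiv ℝ (F i) (splitFirst n y)).comp (splitFirst n)) (Pi.single i 1) = 0 := by
    intro y
    simpa [Fin.sum_univ_succ, splitFirst_single_zero, splitFirst_single_succ, F]
      using hcont (splitFirst n y)
  let a : Fin (n + 1) → ℝ := Fin.cons t₁ fun _ => -R
  let b : Fin (n + 1) → ℝ := Fin.cons t₂ fun _ => R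
  have hab : a ≤ b := Fin.cases ht fun _ => by simp only [a, b, Fin.cons_succ]; linarith
  have hside : ∀ (k : Fin n) (c : ℝ), |c| = R →
      ∫ x in Set.Icc (a ∘ k.succ.succAbove) (b ∘ k.succ.succAbove),
        F k.succ (splitFirst n (k.succ.insertNth c x)) = 0 := by
    intro k c hc
    refine setIntegral_eq_zero_of_forall_eq_zero fun x hx => ?_
    have hy : k.succ.insertNth (α := fun _ => ℝ) c x 0 ∈ Set.Icc t₁ t₂ := by
      obtain ⟨m, rfl⟩ : ∃ m, n = m + 1 := ⟨n - 1, by have := k.pos; omega⟩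
      have h0 : k.succ.succAbove 0 = 0 := Fin.succ_succAbove_zero k
      have hx0 : k.succ.insertNth (α := fun _ => ℝ) c x 0 = x 0 := by
        conv_lhs => rw [← h0]
        exact Fin.insertNth_apply_succAbove ..
      rw [hx0]
      have h1 := hx.1 0
      have h2 := hx.2 0
      simp only [Function.comp_apply, h0, a, b, Fin.cons_zero] at h1 h2
      exact ⟨h1, h2⟩
    have hn : R ≤ ‖fun i : Fin n => k.succ.insertNth (α := fun _ => ℝ) c x i.succ‖ := by
      refine le_trans ?_ (norm_le_pi_norm _ k)
      simp [hc]
    simp only [F, Fin.cons_succ, splitFirst_apply]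
    exact congrFun (hsupp _ _ hy hn).2 k
  have key := integral_divergence_of_hasFDerivAt_off_countable' a b hab
    (fun i y => F i (splitFirst n y))
    (fun i y => (fderiv ℝ (F i) (splitFirst n y)).comp (splitFirst n)) ∅ Set.countable_empty
    (fun i => ((hF i).continuous.comp (splitFirst n).continuous).continuousOn)
    (fun y _ i => (((hF i).differentiable one_ne_zero) _).hasFDerivAt.comp y
      (splitFirst n).hasFDerivAt)
    (by simp only [hdiv]; exact integrableOn_zero)
  have hfront : ∀ k : Fin n, |b k.succ| = R := fun k => by simp [b, abs_of_pos hR]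
  have hback : ∀ k : Fin n, |a k.succ| = R := fun k => by simp [a, abs_of_pos hR]
  simp only [hdiv, integral_zero, Fin.sum_univ_succ, hside _ _ (hfront _), hside _ _ (hback _),
    sub_zero, Finset.sum_const_zero, add_zero] at key
  have hbox : ∀ t ∈ Set.Icc t₁ t₂,
      ∫ x in Set.Icc (a ∘ Fin.succAbove 0) (b ∘ Fin.succAbove 0),
        F 0 (splitFirst n (Fin.insertNth 0 t x)) = ∫ x, ρ (t, x) := by
    intro t h
    rw [← setIntegral_Icc_eq_integral_of_forall_norm_ge hR fun x hx => (hsupp t x h hx).1]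
    simp [Function.comp_def, a, b, F, splitFirst_apply]
  have h₂ := hbox t₂ (Set.right_mem_Icc.2 ht)
  have h₁ := hbox t₁ (Set.left_mem_Icc.2 ht)
  rw [← h₁, ← h₂]
  exact (sub_eq_zero.1 key.symm).symm

/-- **Integral conservation law for a scalar quantity carried by a compactly supported
4-current** (eqns (3) and (46) of the paper): if `(ρ, j)` is a `C¹` current satisfying the
continuity equation `∂_t ρ + ∑_i ∂_{x_i} j_i = 0`, and both `ρ` and `j` vanish outside a
ball of radius `R` for all times in `[t₁, t₂]`, then the total charge on the time slice
`t = t₁` equals the total charge on the time slice `t = t₂`. -/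
theorem total_charge_conserved
    (t₁ t₂ : ℝ) (ht : t₁ ≤ t₂)
    (ρ : ℝ × (Fin 3 → ℝ) → ℝ) (j : ℝ × (Fin 3 → ℝ) → Fin 3 → ℝ)
    (hρ : ContDiff ℝ 1 ρ) (hj : ContDiff ℝ 1 j)
    (hcont : ∀ p : ℝ × (Fin 3 → ℝ),
      fderiv ℝ ρ p (1, 0) + ∑ i, fderiv ℝ (fun q => j q i) p (0, Pi.single i 1) = 0)
    (hsupp : ∃ R > (0 : ℝ), ∀ (t : ℝ) (x : Fin 3 → ℝ),
      t ∈ Set.Icc t₁ t₂ → R ≤ ‖x‖ → ρ (t, x) = 0 ∧ j (t, x) = 0) :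
    ∫ x : Fin 3 → ℝ, ρ (t₁, x) = ∫ x : Fin 3 → ℝ, ρ (t₂, x) := by
  obtain ⟨R, hR, h⟩ := hsupp
  exact integral_eq_of_divergence_free ht hR hρ hj hcont h
end

section
/- Let m ∈ ℝ and let φ : ℝ⁴ → ℂ be a smooth field satisfying the Klein–Gordon equation in Minkowski space: ∑_μ η^{μμ} ∂_μ² φ = m² φ, where η = diag(−1, 1, 1, 1). Define the Lagrangian density L_M(x) := −∑_ρ η^{ρρ} ∂_ρ (conj ∘ φ)(x) · ∂_ρ φ(x) − m² conj(φ(x)) φ(x) and the energy-momentum tensor T^{μν}(x) := η^{μμ} η^{νν} ( ∂_μ (conj ∘ φ)(x) · ∂_ν φ(x) + ∂_ν (conj ∘ φ)(x) · ∂_μ φ(x) ) + η^{μν} L_M(x) (no summation over the repeated indices in the η factors; η^{μν} = 0 for μ ≠ ν). Then for every ν ∈ Fin 4, ∑_μ ∂_μ T^{μν}(x) = 0 for all x ∈ ℝ⁴. -/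
noncomputable section

/-- Partial derivative `∂_μ` of a `ℂ`-valued function on `ℝ⁴ = Fin 4 → ℝ`
(taken componentwise, i.e. as the real Fréchet derivative in the direction `e_μ`). -/
def pdC (μ : Fin 4) (f : (Fin 4 → ℝ) → ℂ) (x : Fin 4 → ℝ) : ℂ :=
  fderiv ℝ f x (Pi.single μ 1)

/-- The diagonal of the Minkowski metric `η = diag(−1, 1, 1, 1)`. -/
def η : Fin 4 → ℝ := ![-1, 1, 1, 1]

/-- The Lagrangian density `L_M = −∑_ρ η^{ρρ} ∂_ρ φ* ∂_ρ φ − m² φ* φ` of the free complex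
scalar field in Minkowski space (eqn (32) of the paper with `g = η`). -/
def LM (m : ℝ) (φ : (Fin 4 → ℝ) → ℂ) (x : Fin 4 → ℝ) : ℂ :=
  -(∑ ρ, (η ρ : ℂ) * pdC ρ (fun z => (starRingEnd ℂ) (φ z)) x * pdC ρ φ x)
    - (m ^ 2 : ℂ) * (starRingEnd ℂ) (φ x) * φ x

/-- The energy-momentum tensor
`T^{μν} = η^{μμ} η^{νν} (∂_μ φ* ∂_ν φ + ∂_ν φ* ∂_μ φ) + η^{μν} L_M`
of the free complex scalar field (eqns (33)–(34) of the paper in flat spacetime). -/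
def EMtensor (m : ℝ) (φ : (Fin 4 → ℝ) → ℂ) (μ ν : Fin 4) (x : Fin 4 → ℝ) : ℂ :=
  (η μ : ℂ) * (η ν : ℂ) *
      (pdC μ (fun z => (starRingEnd ℂ) (φ z)) x * pdC ν φ x
        + pdC ν (fun z => (starRingEnd ℂ) (φ z)) x * pdC μ φ x)
    + (if μ = ν then (η μ : ℂ) else 0) * LM m φ x

theorem ContDiff.pdC {f : (Fin 4 → ℝ) → ℂ} (hf : ContDiff ℝ (⊤ : ℕ∞) f) (μ : Fin 4) :
    ContDiff ℝ (⊤ : ℕ∞) (pdC μ f) :=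
  (hf.fderiv_right (m := (⊤ : ℕ∞)) (by simp)).clm_apply contDiff_const

section PartialDerivative

variable {f g : (Fin 4 → ℝ) → ℂ} {x : Fin 4 → ℝ}

theorem pdC_add (hf : DifferentiableAt ℝ f x) (hg : DifferentiableAt ℝ g x) (μ : Fin 4) :
    pdC μ (fun y => f y + g y) x = pdC μ f x + pdC μ g x := by
  simp [pdC, fderiv_fun_add hf hg]

theorem pdC_sub (hf : DifferentiableAt ℝ f x) (hg : DifferentiableAt ℝ g x) (μ : Fin 4) :
    pdC μ (fun y => f y - g y) x = pdC μ f x - pdC μ g x := by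
  simp [pdC, fderiv_fun_sub hf hg]

theorem pdC_neg (μ : Fin 4) : pdC μ (fun y => -f y) x = -pdC μ f x := by
  simp [pdC, fderiv_fun_neg]

theorem pdC_mul (hf : DifferentiableAt ℝ f x) (hg : DifferentiableAt ℝ g x) (μ : Fin 4) :
    pdC μ (fun y => f y * g y) x = pdC μ f x * g x + f x * pdC μ g x := by
  simp [pdC, fderiv_fun_mul hf hg]
  ring

theorem pdC_const_mul (hf : DifferentiableAt ℝ f x) (c : ℂ) (μ : Fin 4) :
    pdC μ (fun y => c * f y) x = c * pdC μ f x := by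
  simp [pdC, fderiv_const_mul hf c]

theorem pdC_sum {ι : Type*} {s : Finset ι} {F : ι → (Fin 4 → ℝ) → ℂ}
    (hF : ∀ i ∈ s, DifferentiableAt ℝ (F i) x) (μ : Fin 4) :
    pdC μ (fun y => ∑ i ∈ s, F i y) x = ∑ i ∈ s, pdC μ (F i) x := by
  simp [pdC, fderiv_fun_sum hF]

theorem pdC_conj (f : (Fin 4 → ℝ) → ℂ) (μ : Fin 4) (x : Fin 4 → ℝ) :
    pdC μ (fun y => (starRingEnd ℂ) (f y)) x = (starRingEnd ℂ) (pdC μ f x) := by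
  have h := Complex.conjCLE.comp_fderiv (f := f) (x := x)
  exact congrArg (fun L : (Fin 4 → ℝ) →L[ℝ] ℂ => L (Pi.single μ 1)) h

/-- Partial derivatives of a smooth function commute. -/
theorem pdC_comm (hf : ContDiff ℝ (⊤ : ℕ∞) f) (μ ν : Fin 4) (x : Fin 4 → ℝ) :
    pdC μ (pdC ν f) x = pdC ν (pdC μ f) x := by
  have hd : DifferentiableAt ℝ (fderiv ℝ f) x :=
    (hf.fderiv_right (m := (⊤ : ℕ∞)) (by simp)).differentiable (by simp) x
  have key (α β : Fin 4) :
      pdC α (pdC β f) x = fderiv ℝ (fderiv ℝ f) x (Pi.single α 1) (Pi.single β 1) := by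
    change fderiv ℝ (fun y => fderiv ℝ f y (Pi.single β 1)) x (Pi.single α 1) = _
    simp [fderiv_clm_apply hd (differentiableAt_const _)]
  rw [key, key]
  exact (hf.contDiffAt.isSymmSndFDerivAt (by
    simpa using WithTop.coe_le_coe.2 (le_top : (2 : ℕ∞) ≤ ⊤))).eq _ _

end PartialDerivative

theorem pdC_LM {φ : (Fin 4 → ℝ) → ℂ} (hφ : ContDiff ℝ (⊤ : ℕ∞) φ) (m : ℝ) (ν : Fin 4)
    (x : Fin 4 → ℝ) :
    pdC ν (LM m φ) x =
      -(∑ ρ, (η ρ : ℂ) *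
          ((starRingEnd ℂ) (pdC ρ (pdC ν φ) x) * pdC ρ φ x
            + (starRingEnd ℂ) (pdC ρ φ x) * pdC ρ (pdC ν φ) x))
        - (m ^ 2 : ℂ) *
          ((starRingEnd ℂ) (pdC ν φ x) * φ x + (starRingEnd ℂ) (φ x) * pdC ν φ x) := by
  have hd : Differentiable ℝ φ := hφ.differentiable (by simp)
  have hd' (μ : Fin 4) : Differentiable ℝ (pdC μ φ) := (hφ.pdC μ).differentiable (by simp)
  have hc : Differentiable ℝ fun y => (starRingEnd ℂ) (φ y) :=
    Complex.conjCLE.differentiable.comp hd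
  have hc' (μ : Fin 4) : Differentiable ℝ fun y => (starRingEnd ℂ) (pdC μ φ y) :=
    Complex.conjCLE.differentiable.comp (hd' μ)
  have hL : LM m φ = fun y =>
      -(∑ ρ, (η ρ : ℂ) * ((starRingEnd ℂ) (pdC ρ φ y) * pdC ρ φ y))
        - (m ^ 2 : ℂ) * ((starRingEnd ℂ) (φ y) * φ y) := by
    funext y
    simp only [LM, pdC_conj, mul_assoc]
  have hk (ρ : Fin 4) : Differentiable ℝ fun y => (starRingEnd ℂ) (pdC ρ φ y) * pdC ρ φ y :=
    (hc' ρ).mul (hd' ρ)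
  have hs : Differentiable ℝ fun y =>
      ∑ ρ, (η ρ : ℂ) * ((starRingEnd ℂ) (pdC ρ φ y) * pdC ρ φ y) :=
    Differentiable.fun_sum fun ρ _ => (hk ρ).const_mul _
  rw [hL, pdC_sub hs.fun_neg.differentiableAt ((hc.fun_mul hd).const_mul _).differentiableAt, pdC_neg,
    pdC_sum fun ρ _ => ((hk ρ).const_mul _).differentiableAt,
    pdC_const_mul (hc.fun_mul hd).differentiableAt, pdC_mul (hc x) (hd x), pdC_conj]
  congr 2
  refine Finset.sum_congr rfl fun ρ _ => ?_
  rw [pdC_const_mul (hk ρ x), pdC_mul (hc' ρ x) (hd' ρ x), pdC_conj, pdC_comm hφ ν ρ]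

theorem pdC_EMtensor {φ : (Fin 4 → ℝ) → ℂ} (hφ : ContDiff ℝ (⊤ : ℕ∞) φ) (m : ℝ)
    (μ ν : Fin 4) (x : Fin 4 → ℝ) :
    pdC μ (EMtensor m φ μ ν) x =
      (η μ : ℂ) * (η ν : ℂ) *
          ((starRingEnd ℂ) (pdC μ (pdC μ φ) x) * pdC ν φ x
            + (starRingEnd ℂ) (pdC μ φ x) * pdC μ (pdC ν φ) x
            + ((starRingEnd ℂ) (pdC μ (pdC ν φ) x) * pdC μ φ x
              + (starRingEnd ℂ) (pdC ν φ x) * pdC μ (pdC μ φ) x))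
        + (if μ = ν then (η μ : ℂ) else 0) * pdC μ (LM m φ) x := by
  have hd : Differentiable ℝ φ := hφ.differentiable (by simp)
  have hd' (μ : Fin 4) : Differentiable ℝ (pdC μ φ) := (hφ.pdC μ).differentiable (by simp)
  have hc : Differentiable ℝ fun y => (starRingEnd ℂ) (φ y) :=
    Complex.conjCLE.differentiable.comp hd
  have hc' (μ : Fin 4) : Differentiable ℝ fun y => (starRingEnd ℂ) (pdC μ φ y) :=
    Complex.conjCLE.differentiable.comp (hd' μ)
  have hk (α β : Fin 4) :
      Differentiable ℝ fun y => (starRingEnd ℂ) (pdC α φ y) * pdC β φ y :=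
    (hc' α).mul (hd' β)
  have hL : Differentiable ℝ (LM m φ) := by
    unfold LM
    simp only [pdC_conj]
    fun_prop
  have hT : EMtensor m φ μ ν = fun y =>
      (η μ : ℂ) * (η ν : ℂ) *
          ((starRingEnd ℂ) (pdC μ φ y) * pdC ν φ y + (starRingEnd ℂ) (pdC ν φ y) * pdC μ φ y)
        + (if μ = ν then (η μ : ℂ) else 0) * LM m φ y := by
    funext y
    simp only [EMtensor, pdC_conj]
  have hkk := (hk μ ν).fun_add (hk ν μ)
  rw [hT, pdC_add (hkk.const_mul _).differentiableAt (hL.const_mul _).differentiableAt,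
    pdC_const_mul hkk.differentiableAt, pdC_const_mul (hL x), pdC_add (hk μ ν x) (hk ν μ x),
    pdC_mul (hc' μ x) (hd' ν x), pdC_mul (hc' ν x) (hd' μ x), pdC_conj, pdC_conj]

/-- **Energy-momentum conservation for the Klein–Gordon field in Minkowski space**
(flat-spacetime instance of eqns (33)–(34) of the paper): if `φ` satisfies the
Klein–Gordon equation `∑_μ η^{μμ} ∂_μ² φ = m² φ`, then `∑_μ ∂_μ T^{μν} = 0` for each `ν`. -/
theorem klein_gordon_energy_momentum_conservation
    (m : ℝ) (φ : (Fin 4 → ℝ) → ℂ) (hφ : ContDiff ℝ (⊤ : ℕ∞) φ)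
    (hKG : ∀ x : Fin 4 → ℝ,
      ∑ μ, (η μ : ℂ) * pdC μ (fun y => pdC μ φ y) x = (m ^ 2 : ℂ) * φ x) :
    ∀ (ν : Fin 4) (x : Fin 4 → ℝ),
      ∑ μ, pdC μ (fun y => EMtensor m φ μ ν y) x = 0 := by
  intro ν x
  have hKG' := congrArg (starRingEnd ℂ) (hKG x)
  simp only [map_sum, map_mul, map_pow, Complex.conj_ofReal] at hKG'
  have hKGx := hKG x
  simp only [pdC_EMtensor hφ, Finset.sum_add_distrib, ite_mul, zero_mul, Finset.sum_ite_eq',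
    Finset.mem_univ, if_true, pdC_LM hφ]
  simp only [Fin.sum_univ_four] at hKG' hKGx ⊢
  linear_combination (η ν : ℂ) * pdC ν φ x * hKG'
    + (η ν : ℂ) * (starRingEnd ℂ) (pdC ν φ x) * hKGx

end
end
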